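/- arXiv:2106.08103 — 3 statements merged into one kernel-verified Lean document; each statement's English description precedes it below -/
import Mathlib

section
/- The 120° net property: let L:[0,2π/3]→[1,2] be defined by L(θ)=2·sin(θ/2+π/6). Then L is continuous and strictly increasing with L(0)=1 and L(2π/3)=2, and for any three points x,y,z∈ℝ² with |y−x|=|z−x| and angle θ=∠zxy∈[0,2π/3], there exists a compact connected set Γ contained in the closed triangle with vertices x,y,z (i.e., in the convex hull of {x,y,z}), containing x, y and z, such that ℋ¹(Γ)=L(θ)·|y−x|. -/
open MeasureTheory Metric Set Filter Topology
open scoped ENNReal NNReal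

noncomputable section

/-- The Euclidean plane. -/
abbrev Plane : Type := EuclideanSpace ℝ (Fin 2)

/-- The 1-dimensional Hausdorff measure `ℋ¹` on the plane. -/
def H1 : Measure Plane := Measure.hausdorffMeasure 1

/-- The measure-theoretic (reduced/essential) boundary `∂*E` of a set `E`: the points where
the volume density of `E` is neither `0` nor `1`. -/
def redBdry (E : Set Plane) : Set Plane :=
  {x : Plane |
    ¬ Tendsto (fun r : ℝ => volume (E ∩ ball x r) / volume (ball x r)) (𝓝[>] 0) (𝓝 0) ∧
    ¬ Tendsto (fun r : ℝ => volume (E ∩ ball x r) / volume (ball x r)) (𝓝[>] 0) (𝓝 1)}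

/-- A measurable set whose boundary has locally finite `ℋ¹`-measure: our rendering of a
set of locally finite perimeter. -/
def LocFinPer (E : Set Plane) : Prop :=
  MeasurableSet E ∧ ∀ R : ℝ, H1 (redBdry E ∩ ball 0 R) < ⊤

/-- The weighted volume `|E| = ∫_E g`. -/
def wVol (g : Plane → ℝ) (E : Set Plane) : ℝ := ∫ x in E, g x

/-- The weighted perimeter `P(E) = ∫_{∂*E} h dℋ¹`. -/
def wPer (h : Plane → ℝ) (E : Set Plane) : ℝ≥0∞ :=
  ∫⁻ x in redBdry E, ENNReal.ofReal (h x) ∂H1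

/-- An `m`-cluster: an essentially disjoint family of sets of locally finite perimeter. -/
structure Cluster (m : ℕ) where
  cell : Fin m → Set Plane
  locFin : ∀ i, LocFinPer (cell i)
  essDisj : ∀ i j, i ≠ j → volume (cell i ∩ cell j) = 0

namespace Cluster

variable {m : ℕ}

/-- The exterior chamber `E₀`. -/
def ext (E : Cluster m) : Set Plane := (⋃ j, E.cell j)ᶜ

/-- All chambers, including the exterior one `E₀` at index `0`. -/
def ecell (E : Cluster m) (i : Fin (m + 1)) : Set Plane :=
  if h : i = 0 then E.ext else E.cell (i.pred h)

/-- The boundary `∂*𝓔` of a cluster. -/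
def bdry (E : Cluster m) : Set Plane := ⋃ i, redBdry (E.cell i)

/-- The weighted volume vector of a cluster. -/
def vol (g : Plane → ℝ) (E : Cluster m) : Fin m → ℝ := fun i => wVol g (E.cell i)

/-- The weighted perimeter of a cluster. -/
def per (h : Plane → ℝ) (E : Cluster m) : ℝ≥0∞ :=
  ∫⁻ x in E.bdry, ENNReal.ofReal (h x) ∂H1

/-- The relative weighted perimeter of a cluster in a set `A`. -/
def perIn (h : Plane → ℝ) (E : Cluster m) (A : Set Plane) : ℝ≥0∞ :=
  ∫⁻ x in E.bdry ∩ A, ENNReal.ofReal (h x) ∂H1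

end Cluster

/-- A minimal cluster: it minimizes the weighted perimeter among clusters with the same
weighted volume vector. -/
def IsMinimal {m : ℕ} (g h : Plane → ℝ) (E : Cluster m) : Prop :=
  ∀ F : Cluster m, F.vol g = E.vol g → E.per h ≤ F.per h

/-- The Euclidean norm of a vector of `ℝ^m`. -/
def eNorm {m : ℕ} (ε : Fin m → ℝ) : ℝ := Real.sqrt (∑ i, ε i ^ 2)

/-- The `ε-ε^β` property for a cluster, with constants `Rβ`, `Cper`, `εbar`. -/
def EpsEps {m : ℕ} (g h : Plane → ℝ) (E : Cluster m) (β Rβ Cper εbar : ℝ) : Prop :=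
  ∀ ε : Fin m → ℝ, eNorm ε ≤ εbar → ∀ x : Plane,
    ∃ F : Cluster m,
      (∀ i, symmDiff (F.cell i) (E.cell i) ⊆ (ball x Rβ)ᶜ) ∧
      F.vol g = (fun i => E.vol g i + ε i) ∧
      F.per h ≤ E.per h + ENNReal.ofReal (Cper * eNorm ε ^ β)

/-- `C_per[t]`: the smallest constant for which the `ε-ε^β` property holds whenever
`|ε| ≤ t`. -/
def CperAt {m : ℕ} (g h : Plane → ℝ) (E : Cluster m) (β Rβ : ℝ) (t : ℝ) : ℝ :=
  sInf {C : ℝ | 0 ≤ C ∧ EpsEps g h E β Rβ C t}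

/-- The Dini property for a nonnegative nondecreasing function vanishing at `0`:
`∑ φ(C⁻ⁿ) < ∞` for every `C > 1`. -/
def DiniFn (φ : ℝ → ℝ) : Prop :=
  MonotoneOn φ (Ici 0) ∧ (∀ t, 0 ≤ φ t) ∧ φ 0 = 0 ∧
    ∀ C : ℝ, 1 < C → Summable fun n : ℕ => φ (C⁻¹ ^ n)

/-- The `1/2`-Dini property: `√φ` satisfies the Dini property. -/
def HalfDiniFn (φ : ℝ → ℝ) : Prop := DiniFn fun t => Real.sqrt (φ t)

/-- `h` admits a modulus of continuity on `K` satisfying the `1/2`-Dini property. -/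
def HalfDiniOn (h : Plane → ℝ) (K : Set Plane) : Prop :=
  ∃ ω : ℝ → ℝ, HalfDiniFn ω ∧ ∀ x ∈ K, ∀ y ∈ K, |h x - h y| ≤ ω (dist x y)

/-- `h` is locally `1/2`-Dini continuous. -/
def LocHalfDini (h : Plane → ℝ) : Prop := ∀ K : Set Plane, IsCompact K → HalfDiniOn h K

/-- `h` is `α`-Hölder on the set `K`. -/
def HolderOnSet (h : Plane → ℝ) (α : ℝ) (K : Set Plane) : Prop :=
  ∃ C : ℝ, 0 ≤ C ∧ ∀ x ∈ K, ∀ y ∈ K, |h x - h y| ≤ C * dist x y ^ α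

/-- `h` is locally `α`-Hölder continuous. -/
def LocHolder (h : Plane → ℝ) (α : ℝ) : Prop :=
  ∀ K : Set Plane, IsCompact K → HolderOnSet h α K

/-- The local `η`-growth condition for the density `g`. -/
def LocalGrowth (g : Plane → ℝ) (η : ℝ) : Prop :=
  ∀ D : Set Plane, Bornology.IsBounded D →
    ∃ Cvol Rη : ℝ, 0 < Cvol ∧ 0 < Rη ∧
      ∀ (x : Plane) (r : ℝ), 0 < r → r < Rη → ball x r ⊆ D →
        wVol g (ball x r) ≤ Cvol * r ^ η

/-- A parametrized `C¹` arc in the plane, with nonvanishing derivative and injective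
parametrization. -/
structure C1ArcP where
  γ : ℝ → Plane
  smooth : ContDiffOn ℝ 1 γ (Icc 0 1)
  inj : InjOn γ (Icc 0 1)
  reg : ∀ t ∈ Icc (0:ℝ) 1, derivWithin γ (Icc 0 1) t ≠ 0

namespace C1ArcP

/-- The trace of an arc. -/
def img (A : C1ArcP) : Set Plane := A.γ '' Icc 0 1

/-- The arc is of class `C^{1,e}`: its derivative is `e`-Hölder. -/
def Holder (A : C1ArcP) (e : ℝ) : Prop :=
  ∃ K : ℝ, 0 ≤ K ∧ ∀ s ∈ Icc (0:ℝ) 1, ∀ t ∈ Icc (0:ℝ) 1,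
    ‖derivWithin A.γ (Icc 0 1) s - derivWithin A.γ (Icc 0 1) t‖ ≤ K * |s - t| ^ e

/-- `x` is an endpoint of the arc `A`. -/
def IsEndpoint (A : C1ArcP) (x : Plane) : Prop := x = A.γ 0 ∨ x = A.γ 1

/-- `v` is the tangent vector of the arc `A` at its endpoint `x`, pointing into the arc. -/
def TangentAt (A : C1ArcP) (x : Plane) (v : Plane) : Prop :=
  (x = A.γ 0 ∧ v = derivWithin A.γ (Icc 0 1) 0) ∨
  (x = A.γ 1 ∧ v = -derivWithin A.γ (Icc 0 1) 1)

end C1ArcP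

/-- The Steiner property for a set `Sb` (typically the boundary of a cluster), with arcs
satisfying the additional property `P`: locally, `Sb` is a finite union of `C¹` arcs
(each with property `P`), distinct arcs only meet at junction points which are common
endpoints, and at each junction point exactly three arcs meet, with tangent vectors
forming three angles of `2π/3`. -/
def SteinerWith (Sb : Set Plane) (P : C1ArcP → Prop) : Prop :=
  ∀ R : ℝ, 0 < R → ∃ (n : ℕ) (A : Fin n → C1ArcP) (J : Finset Plane),
    (∀ i, P (A i)) ∧
    (∀ i, (A i).img ⊆ Sb) ∧
    (Sb ∩ ball 0 R ⊆ ⋃ i, (A i).img) ∧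
    (∀ i j, i ≠ j → ∀ x ∈ (A i).img ∩ (A j).img,
      x ∈ J ∧ (A i).IsEndpoint x ∧ (A j).IsEndpoint x) ∧
    (∀ x ∈ J, ∃ i j k : Fin n, i ≠ j ∧ j ≠ k ∧ i ≠ k ∧
      {l : Fin n | x ∈ (A l).img} = {i, j, k} ∧
      (A i).IsEndpoint x ∧ (A j).IsEndpoint x ∧ (A k).IsEndpoint x ∧
      ∃ u v w : Plane, (A i).TangentAt x u ∧ (A j).TangentAt x v ∧ (A k).TangentAt x w ∧
        InnerProductGeometry.angle u v = 2 * Real.pi / 3 ∧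
        InnerProductGeometry.angle v w = 2 * Real.pi / 3 ∧
        InnerProductGeometry.angle w u = 2 * Real.pi / 3)

/-- The Steiner property. -/
def SteinerProperty (Sb : Set Plane) : Prop := SteinerWith Sb fun _ => True

/-- The standing assumptions of Section 2 of the paper: a minimal cluster `E`, a closed
ball `D = closedBall x₀ rD`, bounds `0 < hmin ≤ h ≤ hmax` on `D`, the `η`-growth
condition on balls inside `D`, and the `ε-ε^β` property for `E`. -/
structure Setting (m : ℕ) where
  g : Plane → ℝ
  h : Plane → ℝ
  E : Cluster m
  x₀ : Plane
  rD : ℝ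
  hmin : ℝ
  hmax : ℝ
  Cvol : ℝ
  η : ℝ
  β : ℝ
  Rη : ℝ
  Rβ : ℝ
  Cper : ℝ
  εbar : ℝ
  rD_pos : 0 < rD
  g_pos : ∀ x, 0 < g x
  h_pos : ∀ x, 0 < h x
  g_lsc : LowerSemicontinuous g
  h_lsc : LowerSemicontinuous h
  g_locInt : LocallyIntegrable g volume
  hmin_pos : 0 < hmin
  hmin_le : ∀ x ∈ closedBall x₀ rD, hmin ≤ h x
  le_hmax : ∀ x ∈ closedBall x₀ rD, h x ≤ hmax
  η_ge_one : 1 ≤ η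
  β_pos : 0 < β
  β_le_one : β ≤ 1
  Rη_pos : 0 < Rη
  Cvol_pos : 0 < Cvol
  growth : ∀ (x : Plane) (r : ℝ), 0 < r → r < Rη → ball x r ⊆ closedBall x₀ rD →
    wVol g (ball x r) ≤ Cvol * r ^ η
  Rβ_pos : 0 < Rβ
  Cper_pos : 0 < Cper
  εbar_pos : 0 < εbar
  minimal : IsMinimal g h E
  epseps : EpsEps g h E β Rβ Cper εbar

namespace Setting

variable {m : ℕ}

/-- The ambient closed ball `D`. -/
def D (S : Setting m) : Set Plane := closedBall S.x₀ S.rD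

/-- The function `t ↦ C_per[t]`. -/
def CperFun (S : Setting m) : ℝ → ℝ := CperAt S.g S.h S.E S.β S.Rβ

/-- Either `ηβ > 1`, or `ηβ = 1`, `t ↦ C_per[t]` is infinitesimal and `C_per[ε̄]` is
smaller than `c₀ · hmin² / (Cvol^β · hmax)`. -/
def Dichotomy (S : Setting m) (c₀ : ℝ) : Prop :=
  1 < S.η * S.β ∨
    (S.η * S.β = 1 ∧ Tendsto S.CperFun (𝓝[>] 0) (𝓝 0) ∧
      S.CperFun S.εbar ≤ c₀ * S.hmin ^ 2 / (S.Cvol ^ S.β * S.hmax))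

/-- Either `ηβ > 1`, or `ηβ = 1`, `t ↦ C_per[t]` satisfies the `1/2`-Dini property and
`C_per[ε̄]` is smaller than `c₀ · hmin² / (Cvol^β · hmax)`. -/
def Dichotomy' (S : Setting m) (c₀ : ℝ) : Prop :=
  1 < S.η * S.β ∨
    (S.η * S.β = 1 ∧ HalfDiniFn S.CperFun ∧
      S.CperFun S.εbar ≤ c₀ * S.hmin ^ 2 / (S.Cvol ^ S.β * S.hmax))

/-- The set of colors (chambers, including the exterior one) meeting `A` in positive
volume. -/
def colorsIn (S : Setting m) (A : Set Plane) : Set (Fin (m + 1)) :=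
  {i | 0 < wVol S.g (S.E.ecell i ∩ A)}

/-- A `3`-color point: at least three chambers meet every ball around `x` in positive
volume. -/
def ThreeColorPt (S : Setting m) (x : Plane) : Prop :=
  ∀ r : ℝ, 0 < r → 3 ≤ (S.colorsIn (ball x r)).ncard

/-- A ball as in Proposition 2.15 of the paper: meeting at most two chambers in positive
volume, and with finitely many boundary points of the cluster on its boundary circle. -/
def TwoColorBall (S : Setting m) (c : Plane) (ρ : ℝ) : Prop :=
  0 < ρ ∧ ball c ρ ⊆ S.D ∧ (S.colorsIn (ball c ρ)).ncard ≤ 2 ∧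
    (S.E.bdry ∩ sphere c ρ).Finite

end Setting

/-- Distance between unoriented directions, represented by vectors. -/
def dirDist (v w : Plane) : ℝ := min (dist v w) (dist v (-w))

/-- The direction of a vector. -/
def dirOf (v : Plane) : Plane := ‖v‖⁻¹ • v

/-- `A` is an injectively parametrized `C¹` curve over an interval, whose (unoriented)
tangent direction at each point is the one prescribed by `τ`. -/
def IsC1CurveWith (A : Set Plane) (τ : Plane → Plane) : Prop :=
  ∃ (I : Set ℝ) (γ : ℝ → Plane),
    (∃ a b : ℝ, I = Icc a b ∨ I = Ico a b ∨ I = Ioc a b ∨ I = Ioo a b) ∧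
    ContDiffOn ℝ 1 γ I ∧ InjOn γ I ∧ γ '' I = A ∧
    ∀ t ∈ I, derivWithin γ I t ≠ 0 ∧ ∃ c : ℝ, c ≠ 0 ∧ derivWithin γ I t = c • τ (γ t)

/-- The interface regularity property with modulus `ξ`: inside every ball contained in `D`
meeting at most two chambers and whose boundary circle contains finitely many points of
`∂*𝓔`, the boundary `∂*𝓔` is a finite union of pairwise disjoint relatively closed `C¹`
curves, whose tangent directions satisfy `|τ(y) - τ(x)| ≤ ξ(|y - x|)`. -/
def InterfaceReg {m : ℕ} (S : Setting m) (ξ : ℝ → ℝ) : Prop :=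
  ∀ (c : Plane) (ρ : ℝ), 0 < ρ → ball c ρ ⊆ S.D →
    (S.colorsIn (ball c ρ)).ncard ≤ 2 →
    (S.E.bdry ∩ sphere c ρ).Finite →
    ∃ (n : ℕ) (A : Fin n → Set Plane) (τ : Plane → Plane),
      (⋃ i, A i) = S.E.bdry ∩ ball c ρ ∧
      (∀ i j, i ≠ j → Disjoint (A i) (A j)) ∧
      (∀ i, ∃ F : Set Plane, IsClosed F ∧ A i = F ∩ ball c ρ) ∧
      (∀ i, IsC1CurveWith (A i) τ) ∧
      (∀ x ∈ S.E.bdry ∩ ball c ρ, ‖τ x‖ = 1) ∧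
      ∀ x ∈ S.E.bdry ∩ ball c ρ, ∀ y ∈ S.E.bdry ∩ ball c ρ,
        dirDist (τ x) (τ y) ≤ ξ (dist x y)

/-- The almost-alignment property of Lemma 2.16: on small circles around boundary points
carrying exactly two boundary points `a`, `b`, the angle `∠axb` is close to `π` and the
length of the boundary inside the disc exceeds the chord length only by a small amount. -/
def AlmostAlign2 {m : ℕ} (S : Setting m) (R₇ : ℝ) (ξ₁ : ℝ → ℝ) : Prop :=
  ∀ (c : Plane) (ρ : ℝ), S.TwoColorBall c ρ →
    ∀ x ∈ S.E.bdry, ∀ r : ℝ, 0 < r → r < R₇ → ball x r ⊆ ball c ρ →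
      ∀ a b : Plane, a ≠ b → S.E.bdry ∩ sphere x r = {a, b} →
        0 < EuclideanGeometry.angle a x b →
        |EuclideanGeometry.angle a x b - Real.pi| ≤ ξ₁ r ∧
        (H1 (S.E.bdry ∩ ball x r)).toReal - dist b a ≤ r / 6 * ξ₁ r ^ 2

/-- The direction `τ` is `δ`-aligned with all points of `∂*𝓔` on the circle `∂B(x,r)`:
the conclusion of Lemma 2.17. -/
def AlignsAt {m : ℕ} (S : Setting m) (δ : ℝ) (x : Plane) (r : ℝ) (τ : Plane) : Prop :=
  ‖τ‖ = 1 ∧ ∀ y ∈ S.E.bdry ∩ sphere x r, dirDist (dirOf (y - x)) τ ≤ δ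

end

/-- The function `L` of Lemma 2.3: `L(θ) = 2 sin(θ/2 + π/6)`. -/
noncomputable def Lfn (θ : ℝ) : ℝ := 2 * Real.sin (θ / 2 + Real.pi / 6)


lemma net_trig (θ : ℝ) : Lfn θ = Real.cos (θ / 2) + Real.sqrt 3 * Real.sin (θ / 2) := by
  unfold Lfn
  rw [Real.sin_add, Real.cos_pi_div_six, Real.sin_pi_div_six]
  ring

lemma net_seg_fun (F y p w : Plane) (hp : p ∈ segment ℝ F y) :
    ∃ b : ℝ, 0 ≤ b ∧ p = F + b • (y - F) ∧ inner ℝ (p - F) w = b * inner ℝ (y - F) w := by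
  rw [segment_eq_image'] at hp
  obtain ⟨b, hb, rfl⟩ := hp
  exact ⟨b, hb.1, rfl, by simp [inner_smul_left]⟩

lemma net_construct (x y z : Plane) (hd : dist y x = dist z x) (hyz : y ≠ z)
    (t : ℝ) (ht0 : 0 ≤ t) (ht1 : 2 * t ≤ 1) (F : Plane)
    (hF : F = x + t • ((y - x) + (z - x))) :
    ∃ Γ : Set Plane, IsCompact Γ ∧ IsConnected Γ ∧ Γ ⊆ convexHull ℝ {x, y, z} ∧
        x ∈ Γ ∧ y ∈ Γ ∧ z ∈ Γ ∧
        H1 Γ = edist F x + edist F y + edist F z := by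
  have hcpt : ∀ a b : Plane, IsCompact (segment ℝ a b) := by
    intro a b
    rw [segment_eq_image']
    exact isCompact_Icc.image (by fun_prop)
  have hconn : ∀ a b : Plane, IsConnected (segment ℝ a b) := fun a b =>
    ⟨⟨a, left_mem_segment ℝ a b⟩, (convex_segment a b).isPreconnected⟩
  have hx : x ∈ convexHull ℝ ({x, y, z} : Set Plane) := subset_convexHull ℝ _ (by simp)
  have hy : y ∈ convexHull ℝ ({x, y, z} : Set Plane) := subset_convexHull ℝ _ (by simp)
  have hz : z ∈ convexHull ℝ ({x, y, z} : Set Plane) := subset_convexHull ℝ _ (by simp)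
  have hFm : F ∈ convexHull ℝ ({x, y, z} : Set Plane) := by
    have hm : (1/2 : ℝ) • y + (1/2 : ℝ) • z ∈ convexHull ℝ ({x, y, z} : Set Plane) :=
      (convex_convexHull ℝ _) hy hz (by norm_num) (by norm_num) (by norm_num)
    have := (convex_convexHull ℝ ({x, y, z} : Set Plane)) hx hm
      (sub_nonneg.2 ht1) (by linarith : (0:ℝ) ≤ 2 * t) (by ring)
    convert this using 1
    rw [hF]
    module
  have hsub : ∀ a ∈ convexHull ℝ ({x, y, z} : Set Plane),
      segment ℝ F a ⊆ convexHull ℝ ({x, y, z} : Set Plane) := fun a ha =>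
    (convex_convexHull ℝ _).segment_subset hFm ha
  -- the separating functional
  have hn : ‖y - x‖ = ‖z - x‖ := by simpa [dist_eq_norm] using hd
  have hort : inner ℝ ((y - x) + (z - x)) (y - z) = 0 := by
    have : y - z = (y - x) - (z - x) := by abel
    rw [this, real_inner_add_sub_eq_zero_iff]
    exact hn
  have hpos : 0 < inner ℝ (y - z) (y - z) := by
    rw [real_inner_self_eq_norm_sq]
    have : 0 < ‖y - z‖ := norm_pos_iff.2 (sub_ne_zero.2 hyz)
    positivity
  have e1 : inner ℝ (x - F) (y - z) = 0 := by
    have : x - F = (-t) • ((y - x) + (z - x)) := by rw [hF]; module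
    rw [this, inner_smul_left, hort]; simp
  have e2 : inner ℝ (y - F) (y - z) = (1/2) * inner ℝ (y - z) (y - z) := by
    have : y - F = (1/2 - t) • ((y - x) + (z - x)) + (1/2 : ℝ) • (y - z) := by rw [hF]; module
    rw [this, inner_add_left, inner_smul_left, inner_smul_left, hort]; simp
  have e3 : inner ℝ (z - F) (y - z) = -((1/2) * inner ℝ (y - z) (y - z)) := by
    have : z - F = (1/2 - t) • ((y - x) + (z - x)) - (1/2 : ℝ) • (y - z) := by rw [hF]; module
    rw [this, inner_sub_left, inner_smul_left, inner_smul_left, hort]; simp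
  have d1 : segment ℝ F x ∩ segment ℝ F y ⊆ {F} := by
    rintro p ⟨h1, h2⟩
    obtain ⟨a, ha, hpa, ia⟩ := net_seg_fun F x p (y - z) h1
    obtain ⟨b, hb, hpb, ib⟩ := net_seg_fun F y p (y - z) h2
    rw [e1] at ia
    rw [e2, ia] at ib
    have : b = 0 := by nlinarith
    simp [hpb, this]
  have d2 : (segment ℝ F x ∪ segment ℝ F y) ∩ segment ℝ F z ⊆ {F} := by
    rintro p ⟨h1, h2⟩
    obtain ⟨b, hb, hpb, ib⟩ := net_seg_fun F z p (y - z) h2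
    have h0 : 0 ≤ inner ℝ (p - F) (y - z) := by
      rcases h1 with h1 | h1
      · obtain ⟨a, ha, hpa, ia⟩ := net_seg_fun F x p (y - z) h1
        rw [ia, e1]; simp
      · obtain ⟨a, ha, hpa, ia⟩ := net_seg_fun F y p (y - z) h1
        rw [ia, e2]; positivity
    rw [ib, e3] at h0
    have : b = 0 := by nlinarith
    simp [hpb, this]
  have hF0 : H1 {F} = 0 := by
    have : NullSingletonClass H1 :=
      Measure.nullSingletonClass_hausdorff Plane one_pos
    exact measure_singleton F
  refine ⟨segment ℝ F x ∪ segment ℝ F y ∪ segment ℝ F z,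
    ((hcpt _ _).union (hcpt _ _)).union (hcpt _ _), ?_, ?_, ?_, ?_, ?_, ?_⟩
  · refine IsConnected.union ⟨F, Or.inl (left_mem_segment ℝ _ _), left_mem_segment ℝ _ _⟩ ?_
      (hconn _ _)
    exact IsConnected.union ⟨F, left_mem_segment ℝ _ _, left_mem_segment ℝ _ _⟩
      (hconn _ _) (hconn _ _)
  · exact union_subset (union_subset (hsub x hx) (hsub y hy)) (hsub z hz)
  · exact Or.inl (Or.inl (right_mem_segment ℝ _ _))
  · exact Or.inl (Or.inr (right_mem_segment ℝ _ _))
  · exact Or.inr (right_mem_segment ℝ _ _)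
  · rw [measure_union₀ (hcpt F z).measurableSet.nullMeasurableSet (measure_mono_null d2 hF0),
      measure_union₀ (hcpt F y).measurableSet.nullMeasurableSet (measure_mono_null d1 hF0)]
    simp only [H1, hausdorffMeasure_segment]

lemma net_main (x y z : Plane) (hd : dist y x = dist z x)
    (hθ : EuclideanGeometry.angle z x y ∈ Icc (0:ℝ) (2 * Real.pi / 3)) :
    ∃ Γ : Set Plane, IsCompact Γ ∧ IsConnected Γ ∧ Γ ⊆ convexHull ℝ {x, y, z} ∧
        x ∈ Γ ∧ y ∈ Γ ∧ z ∈ Γ ∧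
        H1 Γ = ENNReal.ofReal (Lfn (EuclideanGeometry.angle z x y) * dist y x) := by
  by_cases hyz : y = z
  · subst hyz
    refine ⟨segment ℝ x y, ?_, ⟨⟨x, left_mem_segment ℝ x y⟩, (convex_segment x y).isPreconnected⟩,
      ?_, left_mem_segment ℝ x y, right_mem_segment ℝ x y, right_mem_segment ℝ x y, ?_⟩
    · rw [segment_eq_image']
      exact isCompact_Icc.image (by fun_prop)
    · exact (convex_convexHull ℝ _).segment_subset (subset_convexHull ℝ _ (by simp))
        (subset_convexHull ℝ _ (by simp))
    · rw [H1, hausdorffMeasure_segment, edist_comm, edist_dist]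
      by_cases hxy : y = x
      · simp [hxy]
      · rw [EuclideanGeometry.angle_self_of_ne hxy, net_trig]
        simp
  · set θ := EuclideanGeometry.angle z x y with hθdef
    have hn : ‖y - x‖ = ‖z - x‖ := by simpa [dist_eq_norm] using hd
    have hπ := Real.pi_pos
    have hin : inner ℝ (z - x) (y - x) = ‖y - x‖ ^ 2 * Real.cos θ := by
      have := InnerProductGeometry.cos_angle_mul_norm_mul_norm (z - x) (y - x)
      rw [hθdef, EuclideanGeometry.angle, vsub_eq_sub, vsub_eq_sub, ← this, hn]
      ring
    set c := Real.cos (θ / 2) with hc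
    set s := Real.sin (θ / 2) with hs
    have hcs : s ^ 2 + c ^ 2 = 1 := Real.sin_sq_add_cos_sq _
    have hcos : Real.cos θ = 2 * c ^ 2 - 1 := by
      rw [hc, ← Real.cos_two_mul]; congr 1; ring
    rw [hcos] at hin
    have hs0 : 0 ≤ s := Real.sin_nonneg_of_nonneg_of_le_pi (by linarith [hθ.1])
      (by linarith [hθ.2])
    have hc1 : 1 / 2 ≤ c := by
      rw [hc, ← Real.cos_pi_div_three]
      exact Real.cos_le_cos_of_nonneg_of_le_pi (by linarith [hθ.1]) (by linarith)
        (by linarith [hθ.2])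
    have hc0 : 0 < c := by linarith
    set q := Real.sqrt 3 with hq
    have hq0 : 0 < q := by positivity
    have hq2 : q ^ 2 = 3 := Real.sq_sqrt (by norm_num)
    have hsc : s ≤ q * c := by
      refine (sq_le_sq₀ hs0 (by positivity)).1 ?_
      rw [mul_pow, hq2]; nlinarith
    obtain ⟨t, ht⟩ : ∃ t : ℝ, t = (1 - q * s / (3 * c)) / 2 := ⟨_, rfl⟩
    have htc : (1 - 2 * t) * c = q * s / 3 := by rw [ht]; field_simp; ring
    have ht1 : 2 * t ≤ 1 := by
      have : 0 ≤ q * s / (3 * c) := by positivity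
      linarith
    have ht0 : 0 ≤ t := by
      have : q * s / (3 * c) ≤ 1 := by
        rw [div_le_one (by positivity)]
        nlinarith
      linarith
    obtain ⟨Γ, h1, h2, h3, h4, h5, h6, h7⟩ := net_construct x y z hd hyz t ht0 ht1 _ rfl
    refine ⟨Γ, h1, h2, h3, h4, h5, h6, ?_⟩
    set r := ‖y - x‖ with hr
    have hr0 : 0 ≤ r := norm_nonneg _
    have hin' : inner ℝ (y - x) (z - x) = r ^ 2 * (2 * c ^ 2 - 1) := by
      rw [real_inner_comm]; exact hin
    have key : ∀ a b : ℝ, ‖a • (y - x) + b • (z - x)‖ ^ 2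
        = r ^ 2 * (a ^ 2 + b ^ 2 + 2 * a * b * (2 * c ^ 2 - 1)) := by
      intro a b
      rw [norm_add_sq_real, norm_smul, norm_smul, inner_smul_left, inner_smul_right, hin', ← hn,
        mul_pow, mul_pow, Real.norm_eq_abs, Real.norm_eq_abs, sq_abs, sq_abs]
      simp only [conj_trivial]
      ring
    have hsq : ∀ (w : Plane) (m : ℝ), 0 ≤ m → ‖w‖ ^ 2 = m ^ 2 → ‖w‖ = m := fun w m hm h =>
      (sq_eq_sq₀ (norm_nonneg _) hm).1 h
    have hfin : ∀ T : ℝ, T * c = q * s / 3 → T ^ 2 * c ^ 2 = s ^ 2 / 3 := by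
      intro T hT
      rw [← mul_pow, hT, div_pow, mul_pow, hq2]; ring
    have h8 := hfin _ htc
    have n1 : dist (x + t • ((y - x) + (z - x))) x = r * (c - q * s / 3) := by
      rw [dist_eq_norm]
      have hle : 0 ≤ c - q * s / 3 := by rw [← htc]; nlinarith
      apply hsq _ _ (by positivity)
      rw [show x + t • ((y - x) + (z - x)) - x = t • (y - x) + t • (z - x) by module, key, ← htc]
      ring
    have n2 : dist (x + t • ((y - x) + (z - x))) y = r * (2 * q * s / 3) := by
      rw [dist_eq_norm]
      apply hsq _ _ (by positivity)
      rw [show x + t • ((y - x) + (z - x)) - y = (t - 1) • (y - x) + t • (z - x) by module, key]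
      rw [mul_pow, div_pow, mul_pow, mul_pow, hq2]
      congr 1
      linear_combination h8 - hcs
    have n3 : dist (x + t • ((y - x) + (z - x))) z = r * (2 * q * s / 3) := by
      rw [dist_eq_norm]
      apply hsq _ _ (by positivity)
      rw [show x + t • ((y - x) + (z - x)) - z = t • (y - x) + (t - 1) • (z - x) by module, key]
      rw [mul_pow, div_pow, mul_pow, mul_pow, hq2]
      congr 1
      linear_combination h8 - hcs
    rw [h7, edist_dist, edist_dist, edist_dist, ← ENNReal.ofReal_add dist_nonneg dist_nonneg,
      ← ENNReal.ofReal_add (by positivity) dist_nonneg, n1, n2, n3, net_trig, dist_eq_norm]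
    congr 1
    ring

/-- the `120°` net property. -/
theorem net_property :
    StrictMonoOn Lfn (Icc 0 (2 * Real.pi / 3)) ∧
    ContinuousOn Lfn (Icc 0 (2 * Real.pi / 3)) ∧
    Lfn 0 = 1 ∧ Lfn (2 * Real.pi / 3) = 2 ∧
    (∀ θ ∈ Icc (0:ℝ) (2 * Real.pi / 3), Lfn θ ∈ Icc (1:ℝ) 2) ∧
    ∀ x y z : Plane, dist y x = dist z x →
      EuclideanGeometry.angle z x y ∈ Icc (0:ℝ) (2 * Real.pi / 3) →
      ∃ Γ : Set Plane, IsCompact Γ ∧ IsConnected Γ ∧ Γ ⊆ convexHull ℝ {x, y, z} ∧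
        x ∈ Γ ∧ y ∈ Γ ∧ z ∈ Γ ∧
        H1 Γ = ENNReal.ofReal (Lfn (EuclideanGeometry.angle z x y) * dist y x) := by
  have hπ := Real.pi_pos
  have hmono : StrictMonoOn Lfn (Icc 0 (2 * Real.pi / 3)) := by
    intro a ha b hb hab
    unfold Lfn
    have := Real.sin_lt_sin_of_lt_of_le_pi_div_two (x := a / 2 + Real.pi / 6)
      (y := b / 2 + Real.pi / 6) (by linarith [ha.1]) (by linarith [hb.2]) (by linarith)
    linarith
  have h0 : Lfn 0 = 1 := by rw [net_trig]; simp
  have h2 : Lfn (2 * Real.pi / 3) = 2 := by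
    unfold Lfn
    rw [show 2 * Real.pi / 3 / 2 + Real.pi / 6 = Real.pi / 2 by ring, Real.sin_pi_div_two]
    norm_num
  have m0 : (0:ℝ) ∈ Icc (0:ℝ) (2 * Real.pi / 3) := ⟨le_rfl, by positivity⟩
  have m1 : (2 * Real.pi / 3) ∈ Icc (0:ℝ) (2 * Real.pi / 3) := ⟨by positivity, le_rfl⟩
  refine ⟨hmono, ?_, h0, h2, ?_, net_main⟩
  · unfold Lfn
    fun_prop
  · intro θ hθ
    exact ⟨h0 ▸ hmono.monotoneOn m0 hθ hθ.1, h2 ▸ hmono.monotoneOn hθ m1 hθ.2⟩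
end

section
/- Existence and uniqueness of the Fermat point for an isoceles triangle with apex angle at most 120°: let x,y,z∈ℝ² with y≠z, |y−x|=|z−x|, and angle θ=∠zxy∈(0,2π/3). Then there exists a unique point w contained in the closed triangle with vertices x,y,z such that the three angles ∠ywz, ∠zwx and ∠xwy are all equal to 2π/3. -/
open MeasureTheory Metric Set Filter Topology
open scoped ENNReal NNReal

section FermatHelpers

variable {V : Type*} [NormedAddCommGroup V] [InnerProductSpace ℝ V]

lemma fermat_cos : Real.cos (2 * Real.pi / 3) = -1 / 2 := by
  have : 2 * Real.pi / 3 = Real.pi - Real.pi / 3 := by ring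
  rw [this, Real.cos_pi_sub, Real.cos_pi_div_three]; norm_num

lemma fermat_angle_of {a b : V} (ha : a ≠ 0) (hb : b ≠ 0)
    (h : inner ℝ a b = -(‖a‖ * ‖b‖) / 2) :
    InnerProductGeometry.angle a b = 2 * Real.pi / 3 := by
  have h1 : ‖a‖ ≠ 0 := norm_ne_zero_iff.2 ha
  have h2 : ‖b‖ ≠ 0 := norm_ne_zero_iff.2 hb
  unfold InnerProductGeometry.angle
  have h3 : inner ℝ a b / (‖a‖ * ‖b‖) = Real.cos (2 * Real.pi / 3) := by
    rw [h, fermat_cos]; field_simp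
  rw [h3, Real.arccos_cos] <;> linarith [Real.pi_pos]

lemma fermat_ne {a b : V} (h : InnerProductGeometry.angle a b = 2 * Real.pi / 3) :
    a ≠ 0 := by
  rintro rfl
  rw [InnerProductGeometry.angle_zero_left] at h
  linarith [Real.pi_pos]

/-- Polar form of three vectors making angles of 120 degrees. -/
lemma fermat_units {a b c : V} (h1 : InnerProductGeometry.angle a b = 2 * Real.pi / 3)
    (h2 : InnerProductGeometry.angle b c = 2 * Real.pi / 3)
    (h3 : InnerProductGeometry.angle c a = 2 * Real.pi / 3) :
    ∃ (p q r : V) (s t u : ℝ), 0 < s ∧ 0 < t ∧ 0 < u ∧ a = s • p ∧ b = t • q ∧ c = u • r ∧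
      inner ℝ p p = 1 ∧ inner ℝ q q = 1 ∧ inner ℝ r r = 1 ∧ inner ℝ p q = -1 / 2 ∧
      p + q + r = 0 := by
  have key : ∀ {a b : V}, InnerProductGeometry.angle a b = 2 * Real.pi / 3 → a ≠ 0 → b ≠ 0 →
      inner ℝ (‖a‖⁻¹ • a) (‖b‖⁻¹ • b) = (-1 / 2 : ℝ) := by
    intro a b h ha hb
    have h1 : ‖a‖ ≠ 0 := norm_ne_zero_iff.2 ha
    have h2 : ‖b‖ ≠ 0 := norm_ne_zero_iff.2 hb
    have := InnerProductGeometry.cos_angle_mul_norm_mul_norm a b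
    rw [h, fermat_cos] at this
    rw [real_inner_smul_left, real_inner_smul_right, ← this]
    field_simp
  have unit : ∀ {a : V}, a ≠ 0 → inner ℝ (‖a‖⁻¹ • a) (‖a‖⁻¹ • a) = (1 : ℝ) := by
    intro a ha
    have h1 : ‖a‖ ≠ 0 := norm_ne_zero_iff.2 ha
    rw [real_inner_smul_left, real_inner_smul_right, real_inner_self_eq_norm_sq]
    field_simp
  have back : ∀ {a : V}, a ≠ 0 → a = ‖a‖ • (‖a‖⁻¹ • a) := by
    intro a ha
    rw [smul_smul, mul_inv_cancel₀ (norm_ne_zero_iff.2 ha), one_smul]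
  have ha := fermat_ne h1
  have hb := fermat_ne h2
  have hc := fermat_ne h3
  have k1 := key h1 ha hb
  have k2 := key h2 hb hc
  have k3 := key h3 hc ha
  refine ⟨_, _, _, ‖a‖, ‖b‖, ‖c‖, norm_pos_iff.2 ha, norm_pos_iff.2 hb, norm_pos_iff.2 hc,
    back ha, back hb, back hc, unit ha, unit hb, unit hc, k1, ?_⟩
  rw [← inner_self_eq_zero (𝕜 := ℝ)]
  have u1 := unit ha
  have u2 := unit hb
  have u3 := unit hc
  generalize ‖a‖⁻¹ • a = p at *
  generalize ‖b‖⁻¹ • b = q at *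
  generalize ‖c‖⁻¹ • c = r at *
  simp only [inner_add_left, inner_add_right]
  rw [real_inner_comm p q, real_inner_comm q r, real_inner_comm r p]
  linarith [real_inner_comm p q, real_inner_comm q r, real_inner_comm r p]

/-- Monotonicity of unit vector fields. -/
lemma fermat_mono {p p' : V} (hp : inner ℝ p p = (1 : ℝ)) (hp' : inner ℝ p' p' = (1 : ℝ))
    {s s' : ℝ} (hs : 0 < s) (hs' : 0 < s') {v : V} (hv : v = s • p - s' • p') :
    0 ≤ inner ℝ (p - p') v ∧ (inner ℝ (p - p') v = (0 : ℝ) → v = (s - s') • p) := by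
  have e : inner ℝ (p - p') v = (s + s') * (1 - inner ℝ p p') := by
    rw [hv]
    simp only [inner_sub_left, inner_sub_right, real_inner_smul_right, hp, hp',
      real_inner_comm p p']
    ring
  have n : inner ℝ (p - p') (p - p') = 2 * (1 - inner ℝ p p') := by
    simp only [inner_sub_left, inner_sub_right, hp, hp', real_inner_comm p p']
    ring
  have n0 : 0 ≤ inner ℝ (p - p') (p - p') := real_inner_self_nonneg
  constructor
  · rw [e]; apply mul_nonneg <;> linarith
  · intro h
    rw [e] at h
    have h1 : 1 - inner ℝ p p' = 0 := by
      rcases mul_eq_zero.1 h with h | h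
      · linarith
      · exact h
    rw [h1, mul_zero] at n
    have : p - p' = 0 := inner_self_eq_zero.1 n
    have : p = p' := sub_eq_zero.1 this
    rw [hv, ← this, sub_smul]

lemma fermat_unique {a b c a' b' c' v : V}
    (ha : v = a - a') (hb : v = b - b') (hc : v = c - c')
    (h1 : InnerProductGeometry.angle a b = 2 * Real.pi / 3)
    (h2 : InnerProductGeometry.angle b c = 2 * Real.pi / 3)
    (h3 : InnerProductGeometry.angle c a = 2 * Real.pi / 3)
    (h1' : InnerProductGeometry.angle a' b' = 2 * Real.pi / 3)
    (h2' : InnerProductGeometry.angle b' c' = 2 * Real.pi / 3)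
    (h3' : InnerProductGeometry.angle c' a' = 2 * Real.pi / 3) : v = 0 := by
  obtain ⟨p, q, r, s, t, u, hs, ht, hu, rfl, rfl, rfl, hp, hq, hr, hpq, hsum⟩ :=
    fermat_units h1 h2 h3
  obtain ⟨p', q', r', s', t', u', hs', ht', hu', rfl, rfl, rfl, hp', hq', hr', hpq', hsum'⟩ :=
    fermat_units h1' h2' h3'
  obtain ⟨m1, e1⟩ := fermat_mono hp hp' hs hs' ha
  obtain ⟨m2, e2⟩ := fermat_mono hq hq' ht ht' hb
  obtain ⟨m3, e3⟩ := fermat_mono hr hr' hu hu' hc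
  have tot : inner ℝ (p - p') v + inner ℝ (q - q') v + inner ℝ (r - r') v = (0 : ℝ) := by
    rw [← inner_add_left, ← inner_add_left]
    have : p - p' + (q - q') + (r - r') = (p + q + r) - (p' + q' + r') := by abel
    rw [this, hsum, hsum', sub_zero, inner_zero_left]
  have f1 := e1 (by linarith)
  have f2 := e2 (by linarith)
  have g1 : inner ℝ p v = s - s' := by
    rw [f1, real_inner_smul_right, hp, mul_one]
  have g1' : inner ℝ p v = (t - t') * (-1 / 2) := by
    rw [f2, real_inner_smul_right, hpq]
  have g2 : inner ℝ q v = t - t' := by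
    rw [f2, real_inner_smul_right, hq, mul_one]
  have g2' : inner ℝ q v = (s - s') * (-1 / 2) := by
    rw [f1, real_inner_smul_right, real_inner_comm, hpq]
  have : s - s' = 0 := by linarith
  rw [f1, this, zero_smul]

/-- Existence, in terms of the median `m` and the half base `d`. -/
lemma fermat_exists {m d : V} (hmd : inner ℝ m d = (0 : ℝ)) (hd : d ≠ 0)
    (hlt : ‖d‖ ^ 2 < 3 * ‖m‖ ^ 2) :
    ∃ k : ℝ, 0 < k ∧ k < 1 ∧
      InnerProductGeometry.angle (k • m + d) (k • m - d) = 2 * Real.pi / 3 ∧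
      InnerProductGeometry.angle (k • m - d) ((k - 1) • m) = 2 * Real.pi / 3 ∧
      InnerProductGeometry.angle ((k - 1) • m) (k • m + d) = 2 * Real.pi / 3 := by
  have hD : 0 < ‖d‖ := norm_pos_iff.2 hd
  have hM : 0 < ‖m‖ := by
    rcases (norm_nonneg m).lt_or_eq with h | h
    · exact h
    · rw [← h] at hlt; nlinarith
  have h3 : 0 < Real.sqrt 3 := by positivity
  have h3' : Real.sqrt 3 ^ 2 = 3 := Real.sq_sqrt (by norm_num)
  have hm0 : m ≠ 0 := norm_pos_iff.1 hM
  obtain ⟨k, hk⟩ : ∃ k : ℝ, k = ‖d‖ / (Real.sqrt 3 * ‖m‖) := ⟨_, rfl⟩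
  have hk0 : 0 < k := by rw [hk]; positivity
  have hk3 : ‖d‖ ^ 2 = 3 * (k * ‖m‖) ^ 2 := by
    rw [hk]; field_simp; rw [h3']
  have hk1 : k < 1 := by
    by_contra hh
    push Not at hh
    rw [hk3] at hlt
    have h5 : ‖m‖ ≤ k * ‖m‖ := le_mul_of_one_le_left hM.le hh
    nlinarith
  have nk : ‖k • m‖ = k * ‖m‖ := by
    rw [norm_smul, Real.norm_eq_abs, abs_of_pos hk0]
  have hdm : inner ℝ d m = (0 : ℝ) := by rw [real_inner_comm, hmd]
  have i1 : inner ℝ (k • m + d) (k • m + d) = (4 * (k * ‖m‖) ^ 2 : ℝ) := by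
    simp only [inner_add_left, inner_add_right, real_inner_smul_left, real_inner_smul_right,
      hmd, hdm, real_inner_self_eq_norm_sq, nk]
    rw [hk3]; ring
  have i2 : inner ℝ (k • m - d) (k • m - d) = (4 * (k * ‖m‖) ^ 2 : ℝ) := by
    simp only [inner_sub_left, inner_sub_right, real_inner_smul_left, real_inner_smul_right,
      hmd, hdm, real_inner_self_eq_norm_sq, nk]
    rw [hk3]; ring
  have hkM : 0 < k * ‖m‖ := mul_pos hk0 hM
  have n1 : ‖k • m + d‖ = 2 * (k * ‖m‖) := by
    rw [real_inner_self_eq_norm_sq] at i1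
    rw [← sq_eq_sq₀ (norm_nonneg _) (by positivity), i1]; ring
  have n2 : ‖k • m - d‖ = 2 * (k * ‖m‖) := by
    rw [real_inner_self_eq_norm_sq] at i2
    rw [← sq_eq_sq₀ (norm_nonneg _) (by positivity), i2]; ring
  have n3 : ‖(k - 1) • m‖ = (1 - k) * ‖m‖ := by
    rw [norm_smul, Real.norm_eq_abs, abs_of_neg (by linarith)]; ring
  have z1 : k • m + d ≠ 0 := by rw [← norm_pos_iff, n1]; positivity
  have z2 : k • m - d ≠ 0 := by rw [← norm_pos_iff, n2]; positivity
  have z3 : (k - 1) • m ≠ 0 := by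
    rw [← norm_pos_iff, n3]; exact mul_pos (by linarith) hM
  refine ⟨k, hk0, hk1, fermat_angle_of z1 z2 ?_, fermat_angle_of z2 z3 ?_,
    fermat_angle_of z3 z1 ?_⟩
  · rw [n1, n2]
    simp only [inner_add_left, inner_sub_right, real_inner_smul_left, real_inner_smul_right,
      hmd, hdm, real_inner_self_eq_norm_sq, nk]
    rw [hk3]; ring
  · rw [n3, n2]
    simp only [inner_sub_left, real_inner_smul_left, real_inner_smul_right,
      hmd, hdm, real_inner_self_eq_norm_sq]
    ring
  · rw [n3, n1]
    simp only [inner_add_right, real_inner_smul_left, real_inner_smul_right,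
      hmd, hdm, real_inner_self_eq_norm_sq]
    ring

end FermatHelpers

/-- existence and uniqueness of the Fermat point of an isoceles triangle
with apex angle in `(0, 2π/3)`. -/
theorem fermat_point (x y z : Plane) (hyz : y ≠ z) (hiso : dist y x = dist z x)
    (hθ : EuclideanGeometry.angle z x y ∈ Ioo 0 (2 * Real.pi / 3)) :
    ∃! w : Plane, w ∈ convexHull ℝ {x, y, z} ∧
      EuclideanGeometry.angle y w z = 2 * Real.pi / 3 ∧
      EuclideanGeometry.angle z w x = 2 * Real.pi / 3 ∧
      EuclideanGeometry.angle x w y = 2 * Real.pi / 3 := by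
  simp only [EuclideanGeometry.angle, vsub_eq_sub] at hθ ⊢
  rw [dist_eq_norm, dist_eq_norm] at hiso
  obtain ⟨m, hm⟩ : ∃ m : Plane, m = (1 / 2 : ℝ) • ((y - x) + (z - x)) := ⟨_, rfl⟩
  obtain ⟨d, hd⟩ : ∃ d : Plane, d = (1 / 2 : ℝ) • ((y - x) - (z - x)) := ⟨_, rfl⟩
  have ea : y - x = m + d := by rw [hm, hd]; module
  have eb : z - x = m - d := by rw [hm, hd]; module
  have hd0 : d ≠ 0 := by
    intro h
    rw [h] at ea eb
    apply hyz
    have : y - x = z - x := by rw [ea, eb]; simp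
    exact sub_left_injective this
  have hmd : inner ℝ m d = (0 : ℝ) := by
    have h1 := norm_add_sq_real m d
    have h2 := norm_sub_sq_real m d
    rw [← ea, hiso] at h1
    rw [← eb] at h2
    linarith
  have hL : ‖z - x‖ ^ 2 = ‖m‖ ^ 2 + ‖d‖ ^ 2 := by
    rw [eb, norm_sub_sq_real, hmd]; ring
  have hlt : ‖d‖ ^ 2 < 3 * ‖m‖ ^ 2 := by
    have hc := Real.cos_lt_cos_of_nonneg_of_le_pi hθ.1.le (by linarith [Real.pi_pos]) hθ.2
    rw [fermat_cos] at hc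
    have hi := InnerProductGeometry.cos_angle_mul_norm_mul_norm (z - x) (y - x)
    have hI : inner ℝ (z - x) (y - x) = ‖m‖ ^ 2 - ‖d‖ ^ 2 := by
      rw [eb, ea]
      simp only [inner_sub_left, inner_add_right, hmd, real_inner_comm m d,
        real_inner_self_eq_norm_sq]
      ring
    rw [hI, hiso] at hi
    have hpos : 0 < ‖z - x‖ ^ 2 := by
      rw [hL]
      have := norm_pos_iff.2 hd0
      positivity
    nlinarith
  obtain ⟨k, hk0, hk1, a1, a2, a3⟩ := fermat_exists hmd hd0 hlt
  have w1 : y - (x + (1 - k) • m) = k • m + d := by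
    have : y = x + (m + d) := by rw [← ea]; abel
    rw [this]; module
  have w2 : z - (x + (1 - k) • m) = k • m - d := by
    have : z = x + (m - d) := by rw [← eb]; abel
    rw [this]; module
  have w3 : x - (x + (1 - k) • m) = (k - 1) • m := by module
  refine ⟨x + (1 - k) • m, ⟨?_, ?_, ?_, ?_⟩, ?_⟩
  · rw [convexHull_insert (by simp), convexHull_pair, mem_convexJoin]
    refine ⟨x, rfl, (1 / 2 : ℝ) • y + (1 / 2 : ℝ) • z,
      ⟨1 / 2, 1 / 2, by norm_num, by norm_num, by norm_num, rfl⟩,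
      ⟨k, 1 - k, hk0.le, by linarith, by ring, ?_⟩⟩
    rw [hm]; module
  · rw [w1, w2]; exact a1
  · rw [w2, w3]; exact a2
  · rw [w3, w1]; exact a3
  · rintro w ⟨-, b1, b2, b3⟩
    rw [← w1, ← w2] at a1
    rw [← w2, ← w3] at a2
    rw [← w3, ← w1] at a3
    have := fermat_unique (v := x + (1 - k) • m - w) (by abel) (by abel) (by abel)
      b1 b2 b3 a1 a2 a3
    exact (sub_eq_zero.1 this).symm
end

section
/- Growth estimate for the Grushin volume density: fix α≥0 and let g(t)=|(1+α)t₁|^{−α/(1+α)} for t=(t₁,t₂)∈ℝ². For x∈ℝ² and r>0 let Q(x,r)=[x₁−r,x₁+r]×[x₂−r,x₂+r]. Then ∫_{Q(x,r)} g(t) dt ≤ ∫_{Q(0,r)} g(t) dt = 4·(1+α)^{1/(1+α)}·r^{(α+2)/(α+1)}. In particular, the η-growth condition holds for this density with η=(α+2)/(α+1). -/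
open MeasureTheory Metric Set Filter Topology
open scoped ENNReal NNReal

/-- The Grushin volume density (after the change of coordinates of [MM]). -/
noncomputable def grushinG (α : ℝ) : Plane → ℝ :=
  fun x => |(1 + α) * x 0| ^ (-(α / (1 + α)))

/-- The square `Q(x,r) = [x₁-r, x₁+r] × [x₂-r, x₂+r]`. -/
def Qsq (x : Plane) (r : ℝ) : Set Plane :=
  {t : Plane | t 0 ∈ Icc (x 0 - r) (x 0 + r) ∧ t 1 ∈ Icc (x 1 - r) (x 1 + r)}


/-- The coordinates of the plane as a measurable equivalence. -/
noncomputable def grPhi : Plane ≃ᵐ ℝ × ℝ :=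
  (MeasurableEquiv.toLp 2 (Fin 2 → ℝ)).symm.trans MeasurableEquiv.finTwoArrow

theorem grPhi_mp : MeasurePreserving grPhi volume volume :=
  (volume_preserving_finTwoArrow ℝ).comp
    (EuclideanSpace.volume_preserving_symm_measurableEquiv_toLp (Fin 2))

theorem grPhi_apply (x : Plane) : grPhi x = (x 0, x 1) := rfl

/-- The one-dimensional density. -/
noncomputable def grf (α : ℝ) (t : ℝ) : ℝ := |(1 + α) * t| ^ (-(α / (1 + α)))

theorem grf_nonneg (α t : ℝ) : 0 ≤ grf α t := Real.rpow_nonneg (abs_nonneg _) _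

theorem Qsq_eq (x : Plane) (r : ℝ) :
    Qsq x r = grPhi ⁻¹' (Icc (x 0 - r) (x 0 + r) ×ˢ Icc (x 1 - r) (x 1 + r)) := by
  ext t
  simp only [Qsq, mem_preimage, grPhi_apply, mem_prod]
  rfl

theorem grExp (α : ℝ) (hα : 0 ≤ α) : -1 < -(α / (1 + α)) := by
  have : α / (1 + α) < 1 := by rw [div_lt_one (by linarith)]; linarith
  linarith

theorem grf_of_nonneg (α : ℝ) (hα : 0 ≤ α) (t : ℝ) (ht : 0 ≤ t) :
    grf α t = (1 + α) ^ (-(α / (1 + α))) * t ^ (-(α / (1 + α))) := by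
  have h1 : 0 ≤ 1 + α := by linarith
  rw [grf, abs_of_nonneg (mul_nonneg h1 ht), Real.mul_rpow h1 ht]

theorem grf_neg (α t : ℝ) : grf α (-t) = grf α t := by
  simp [grf]

theorem grf_ii_pos (α : ℝ) (hα : 0 ≤ α) (b : ℝ) (hb : 0 ≤ b) :
    IntervalIntegrable (grf α) volume 0 b := by
  have h := (intervalIntegral.intervalIntegrable_rpow' (a := 0) (b := b) (grExp α hα)).const_mul
    ((1 + α) ^ (-(α / (1 + α))))
  refine h.congr ?_
  intro t ht
  rw [uIoc_of_le hb] at ht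
  exact (grf_of_nonneg α hα t ht.1.le).symm

theorem grf_ii_neg (α : ℝ) (hα : 0 ≤ α) (b : ℝ) (hb : 0 ≤ b) :
    IntervalIntegrable (grf α) volume (-b) 0 := by
  have h := (grf_ii_pos α hα b hb).comp_sub_left 0 |>.symm
  simpa [grf_neg] using h

theorem grf_int (α : ℝ) (hα : 0 ≤ α) (a b : ℝ) : IntegrableOn (grf α) (Icc a b) := by
  have hM : 0 ≤ max |a| |b| := le_trans (abs_nonneg a) (le_max_left _ _)
  have h := (grf_ii_neg α hα _ hM).trans (grf_ii_pos α hα _ hM)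
  rw [intervalIntegrable_iff_integrableOn_Icc_of_le (by linarith)] at h
  refine h.mono_set (Icc_subset_Icc ?_ ?_)
  · have := neg_abs_le a
    have := le_max_left |a| |b|
    linarith
  · exact (le_abs_self b).trans (le_max_right _ _)

theorem grf_integral (α : ℝ) (hα : 0 ≤ α) (r : ℝ) (hr : 0 < r) :
    ∫ t in Icc (-r) r, grf α t = 2 * (1 + α) ^ ((1:ℝ) / (1 + α)) * r ^ ((1:ℝ) / (1 + α)) := by
  have h1 : 0 < 1 + α := by linarith
  rw [integral_Icc_eq_integral_Ioc, ← intervalIntegral.integral_of_le (by linarith),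
    ← intervalIntegral.integral_add_adjacent_intervals (grf_ii_neg α hα r hr.le)
      (grf_ii_pos α hα r hr.le)]
  have e1 : ∫ t in (-r)..0, grf α t = ∫ t in (0:ℝ)..r, grf α t := by
    have := intervalIntegral.integral_comp_neg (a := 0) (b := r) (grf α)
    simp only [grf_neg, neg_zero] at this
    exact this.symm
  have e2 : ∫ t in (0:ℝ)..r, grf α t
      = ∫ t in (0:ℝ)..r, (1 + α) ^ (-(α / (1 + α))) * t ^ (-(α / (1 + α))) := by
    refine intervalIntegral.integral_congr ?_
    intro t ht
    rw [uIcc_of_le hr.le] at ht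
    exact grf_of_nonneg α hα t ht.1
  have e3 : -(α / (1 + α)) + 1 = 1 / (1 + α) := by field_simp; ring
  have e4 : (1 + α) ^ ((1:ℝ) / (1 + α)) = (1 + α) ^ (-(α / (1 + α))) * (1 + α) := by
    rw [← e3, Real.rpow_add h1, Real.rpow_one]
  rw [e1, e2, intervalIntegral.integral_const_mul, integral_rpow (Or.inl (grExp α hα)), e3, e4,
    Real.zero_rpow (by positivity)]
  field_simp
  ring

theorem grf_bathtub (α : ℝ) (hα : 0 ≤ α) (x r : ℝ) (hr : 0 < r) :
    ∫ t in Icc (x - r) (x + r), grf α t ≤ ∫ t in Icc (-r) r, grf α t := by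
  have h1 : 0 < 1 + α := by linarith
  have hp : -(α / (1 + α)) ≤ 0 := by
    have : 0 ≤ α / (1 + α) := by positivity
    linarith
  have key : ∫ t in Icc (x - r) (x + r), (grf α t - grf α r)
      ≤ ∫ t in Icc (-r) r, (grf α t - grf α r) := by
    rw [← integral_indicator measurableSet_Icc, ← integral_indicator measurableSet_Icc]
    have hi : ∀ a b : ℝ, Integrable (indicator (Icc a b) fun t => grf α t - grf α r) := by
      intro a b
      refine IntegrableOn.integrable_indicator ?_ measurableSet_Icc
      exact (grf_int α hα a b).sub (by simp)
    refine integral_mono_ae (hi _ _) (hi _ _) ?_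
    filter_upwards [Measure.ae_ne volume (0:ℝ)] with t ht
    by_cases hJ : t ∈ Icc (-r) r
    · have h0 : 0 ≤ grf α t - grf α r := by
        rw [sub_nonneg]
        refine Real.rpow_le_rpow_of_nonpos (by positivity) ?_ hp
        rw [abs_mul, abs_mul, abs_of_pos hr]
        exact mul_le_mul_of_nonneg_left (abs_le.mpr hJ) (abs_nonneg _)
      rw [indicator_of_mem hJ]
      exact indicator_le_self' (fun _ _ => h0) t
    · rw [indicator_of_notMem hJ]
      refine indicator_apply_le' (fun _ => ?_) (fun _ => le_refl _)
      rw [sub_nonpos]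
      refine Real.rpow_le_rpow_of_nonpos (by positivity) ?_ hp
      rw [abs_mul, abs_mul, abs_of_pos hr]
      refine mul_le_mul_of_nonneg_left ?_ (abs_nonneg _)
      by_contra hc
      exact hJ (abs_le.mp (not_le.mp hc).le)
  rw [integral_sub (grf_int α hα _ _) (by simp), integral_sub (grf_int α hα _ _) (by simp)] at key
  have v1 : (x + r - (x - r)) = 2 * r := by ring
  have v2 : (r - -r) = 2 * r := by ring
  simp only [integral_const, measureReal_restrict_apply_univ, Real.volume_real_Icc, v1, v2] at key
  linarith

theorem gr_intOn (α : ℝ) (hα : 0 ≤ α) (x : Plane) (r : ℝ) :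
    IntegrableOn (grushinG α) (Qsq x r) := by
  have h2 : IntegrableOn (fun z : ℝ × ℝ => grf α z.1 * (fun _ : ℝ => (1:ℝ)) z.2)
      (Icc (x 0 - r) (x 0 + r) ×ˢ Icc (x 1 - r) (x 1 + r)) := by
    rw [IntegrableOn, Measure.volume_eq_prod, ← Measure.prod_restrict]
    exact Integrable.mul_prod (g := fun _ : ℝ => (1:ℝ)) (grf_int α hα _ _) (by simp)
  have h3 := (grPhi_mp.integrableOn_comp_preimage grPhi.measurableEmbedding).mpr h2
  rw [Qsq_eq]
  refine h3.congr_fun_ae (Eventually.of_forall fun t => ?_)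
  simp [grPhi_apply, grf, grushinG]

theorem gr_wVol (α : ℝ) (x : Plane) (r : ℝ) (hr : 0 < r) :
    wVol (grushinG α) (Qsq x r) = (∫ t in Icc (x 0 - r) (x 0 + r), grf α t) * (2 * r) := by
  have h := grPhi_mp.setIntegral_preimage_emb grPhi.measurableEmbedding
    (fun z : ℝ × ℝ => grf α z.1 * (fun _ : ℝ => (1:ℝ)) z.2)
    (Icc (x 0 - r) (x 0 + r) ×ˢ Icc (x 1 - r) (x 1 + r))
  rw [← Qsq_eq, Measure.volume_eq_prod, setIntegral_prod_mul (grf α) (fun _ : ℝ => (1:ℝ))] at h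
  have v1 : (x 1 + r - (x 1 - r)) = 2 * r := by ring
  have v2 : max (2 * r) 0 = 2 * r := max_eq_left (by linarith)
  simp only [integral_const, measureReal_restrict_apply_univ, Real.volume_real_Icc, v1, v2,
    smul_eq_mul, mul_one] at h
  rw [← h]
  rfl

theorem ball_sub_Qsq (x : Plane) (r : ℝ) : ball x r ⊆ Qsq x r := by
  intro t ht
  rw [mem_ball, dist_eq_norm] at ht
  have h : ∀ i, |t i - x i| ≤ r := by
    intro i
    have := PiLp.norm_apply_le (t - x) i
    rw [Real.norm_eq_abs] at this
    exact this.trans ht.le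
  have h0 := abs_le.mp (h 0)
  have h1 := abs_le.mp (h 1)
  exact ⟨⟨by linarith [h0.1], by linarith [h0.2]⟩, ⟨by linarith [h1.1], by linarith [h1.2]⟩⟩

/-- growth estimate for the Grushin volume density; in particular the
`η`-growth condition holds with `η = (α+2)/(α+1)`. -/
theorem grushin_growth (α : ℝ) (hα : 0 ≤ α) :
    (∀ (x : Plane) (r : ℝ), 0 < r →
      wVol (grushinG α) (Qsq x r) ≤ wVol (grushinG α) (Qsq 0 r)) ∧
    (∀ r : ℝ, 0 < r →
      wVol (grushinG α) (Qsq 0 r)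
        = 4 * (1 + α) ^ ((1:ℝ) / (1 + α)) * r ^ ((α + 2) / (α + 1))) ∧
    ∃ Cvol Rη : ℝ, 0 < Cvol ∧ 0 < Rη ∧
      ∀ (x : Plane) (r : ℝ), 0 < r → r < Rη →
        wVol (grushinG α) (ball x r) ≤ Cvol * r ^ ((α + 2) / (α + 1)) := by
  have h1 : 0 < 1 + α := by linarith
  have A : ∀ (x : Plane) (r : ℝ), 0 < r →
      wVol (grushinG α) (Qsq x r) ≤ wVol (grushinG α) (Qsq 0 r) := by
    intro x r hr
    rw [gr_wVol α x r hr, gr_wVol α 0 r hr]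
    have := grf_bathtub α hα (x 0) r hr
    simp only [PiLp.zero_apply, zero_sub, zero_add]
    exact mul_le_mul_of_nonneg_right this (by linarith)
  have B : ∀ r : ℝ, 0 < r →
      wVol (grushinG α) (Qsq 0 r)
        = 4 * (1 + α) ^ ((1:ℝ) / (1 + α)) * r ^ ((α + 2) / (α + 1)) := by
    intro r hr
    rw [gr_wVol α 0 r hr]
    simp only [PiLp.zero_apply, zero_sub, zero_add]
    have e : (α + 2) / (α + 1) = 1 / (1 + α) + 1 := by
      rw [add_comm α 1]; field_simp; ring
    rw [grf_integral α hα r hr, e, Real.rpow_add hr, Real.rpow_one]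
    ring
  refine ⟨A, B, 4 * (1 + α) ^ ((1:ℝ) / (1 + α)), 1, by positivity, one_pos, ?_⟩
  intro x r hr _
  rw [← B r hr]
  refine le_trans ?_ (A x r hr)
  refine setIntegral_mono_set (gr_intOn α hα x r) ?_ (ball_sub_Qsq x r).eventuallyLE
  exact Eventually.of_forall fun t => grf_nonneg α (t 0)
end
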